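/- Under the standing hypotheses in the context, if there are a faithful set of left integrals and a faithful set of right integrals, then the counit ε and the bijective anti-multiplicative antipode S : A → A (satisfying m((S ⊗ id)(Δ(a))) = (id ⊗ ε)((1 ⊗ a)·E) and m((id ⊗ S)(Δ(a))) = (ε ⊗ id)(E·(a ⊗ 1)) for all a ∈ A) can be chosen so that, in addition, S(x) = S_B(x) for all x ∈ B and S(y) = S_C(y) for all y ∈ C; that is, the antipode coincides on the source and target algebras with the antipodal maps of the separability idempotent E. -/

import Mathlib

open TensorProduct

/-- Slice map `id ⊗ ω` landing in the left tensor factor. -/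
noncomputable def sL {B C : Type} [AddCommGroup B] [Module ℂ B] [AddCommGroup C] [Module ℂ C]
    (ω : C →ₗ[ℂ] ℂ) : (B ⊗[ℂ] C) →ₗ[ℂ] B :=
  (TensorProduct.rid ℂ B).toLinearMap ∘ₗ LinearMap.lTensor B ω

/-- Slice map `ω ⊗ id` landing in the right tensor factor. -/
noncomputable def sR {B C : Type} [AddCommGroup B] [Module ℂ B] [AddCommGroup C] [Module ℂ C]
    (ω : B →ₗ[ℂ] ℂ) : (B ⊗[ℂ] C) →ₗ[ℂ] C :=
  (TensorProduct.lid ℂ C).toLinearMap ∘ₗ LinearMap.rTensor C ω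

/-- `u ⊗ v ↦ u ⊗ (v ⊗ 1)`, placing `A ⊗ A` in legs 1 and 2 of the triple tensor product. -/
noncomputable def leg12 (A : Type) [Ring A] [Algebra ℂ A] :
    (A ⊗[ℂ] A) →ₗ[ℂ] A ⊗[ℂ] (A ⊗[ℂ] A) :=
  TensorProduct.map LinearMap.id ((TensorProduct.mk ℂ A A).flip 1)

/-- `u ⊗ v ↦ u ⊗ (1 ⊗ v)`, placing `A ⊗ A` in legs 1 and 3 of the triple tensor product. -/
noncomputable def leg13 (A : Type) [Ring A] [Algebra ℂ A] :
    (A ⊗[ℂ] A) →ₗ[ℂ] A ⊗[ℂ] (A ⊗[ℂ] A) :=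
  TensorProduct.map LinearMap.id (TensorProduct.mk ℂ A A 1)

/-- A left integral: a nonzero functional with `(id ⊗ φ)(Δ a) ∈ C` for all `a`. -/
noncomputable def IsLeftIntegral (A : Type) [Ring A] [Algebra ℂ A] (Δ : A →ₗ[ℂ] A ⊗[ℂ] A)
    (C : Subalgebra ℂ A) (φ : A →ₗ[ℂ] ℂ) : Prop :=
  φ ≠ 0 ∧ ∀ a : A, sL φ (Δ a) ∈ C

/-- A right integral: a nonzero functional with `(ψ ⊗ id)(Δ a) ∈ B` for all `a`. -/
noncomputable def IsRightIntegral (A : Type) [Ring A] [Algebra ℂ A] (Δ : A →ₗ[ℂ] A ⊗[ℂ] A)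
    (B : Subalgebra ℂ A) (ψ : A →ₗ[ℂ] ℂ) : Prop :=
  ψ ≠ 0 ∧ ∀ a : A, sR ψ (Δ a) ∈ B

/-- There is a faithful set of left integrals. -/
noncomputable def FaithfulLeftIntegrals (A : Type) [Ring A] [Algebra ℂ A]
    (Δ : A →ₗ[ℂ] A ⊗[ℂ] A) (C : Subalgebra ℂ A) : Prop :=
  (∀ a : A, (∀ φ : A →ₗ[ℂ] ℂ, IsLeftIntegral A Δ C φ → ∀ b : A, φ (a * b) = 0) → a = 0) ∧
  (∀ a : A, (∀ φ : A →ₗ[ℂ] ℂ, IsLeftIntegral A Δ C φ → ∀ b : A, φ (b * a) = 0) → a = 0)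

/-- There is a faithful set of right integrals. -/
noncomputable def FaithfulRightIntegrals (A : Type) [Ring A] [Algebra ℂ A]
    (Δ : A →ₗ[ℂ] A ⊗[ℂ] A) (B : Subalgebra ℂ A) : Prop :=
  (∀ a : A, (∀ ψ : A →ₗ[ℂ] ℂ, IsRightIntegral A Δ B ψ → ∀ b : A, ψ (a * b) = 0) → a = 0) ∧
  (∀ a : A, (∀ ψ : A →ₗ[ℂ] ℂ, IsRightIntegral A Δ B ψ → ∀ b : A, ψ (b * a) = 0) → a = 0)

section Slices

variable {A : Type} [Ring A] [Algebra ℂ A]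

@[simp]
lemma sL_tmul {M N : Type} [AddCommGroup M] [Module ℂ M] [AddCommGroup N] [Module ℂ N]
    (ω : N →ₗ[ℂ] ℂ) (x : M) (y : N) : sL ω (x ⊗ₜ[ℂ] y) = ω y • x := by
  simp [sL]

@[simp]
lemma sR_tmul {M N : Type} [AddCommGroup M] [Module ℂ M] [AddCommGroup N] [Module ℂ N]
    (ω : M →ₗ[ℂ] ℂ) (x : M) (y : N) : sR ω (x ⊗ₜ[ℂ] y) = ω x • y := by
  simp [sR]

lemma sR_mul_one_tmul (ω : A →ₗ[ℂ] ℂ) (z : A ⊗[ℂ] A) (b : A) :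
    sR ω (z * (1 ⊗ₜ[ℂ] b)) = sR ω z * b := by
  induction z with
  | zero => simp
  | tmul x y => simp
  | add x y hx hy => simp [add_mul, hx, hy]

lemma sR_one_tmul_mul (ω : A →ₗ[ℂ] ℂ) (z : A ⊗[ℂ] A) (b : A) :
    sR ω ((1 ⊗ₜ[ℂ] b) * z) = b * sR ω z := by
  induction z with
  | zero => simp
  | tmul x y => simp
  | add x y hx hy => simp [mul_add, hx, hy]

lemma sL_mul_tmul_one (ω : A →ₗ[ℂ] ℂ) (z : A ⊗[ℂ] A) (b : A) :
    sL ω (z * (b ⊗ₜ[ℂ] 1)) = sL ω z * b := by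
  induction z with
  | zero => simp
  | tmul x y => simp
  | add x y hx hy => simp [add_mul, hx, hy]

lemma sL_tmul_one_mul (ω : A →ₗ[ℂ] ℂ) (z : A ⊗[ℂ] A) (b : A) :
    sL ω ((b ⊗ₜ[ℂ] 1) * z) = b * sL ω z := by
  induction z with
  | zero => simp
  | tmul x y => simp
  | add x y hx hy => simp [mul_add, hx, hy]

lemma apply_sL_eq_apply_sR {M N : Type} [AddCommGroup M] [Module ℂ M] [AddCommGroup N]
    [Module ℂ N] (ω : M →ₗ[ℂ] ℂ) (θ : N →ₗ[ℂ] ℂ) (z : M ⊗[ℂ] N) :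
    ω (sL θ z) = θ (sR ω z) := by
  induction z with
  | zero => simp
  | tmul x y => simp [mul_comm]
  | add x y hx hy => simp [hx, hy]

lemma eq_zero_of_sL_eq_zero {M N : Type} [AddCommGroup M] [Module ℂ M] [AddCommGroup N]
    [Module ℂ N] (z : M ⊗[ℂ] N) (h : ∀ ω : N →ₗ[ℂ] ℂ, sL ω z = 0) : z = 0 := by
  classical
  have b := Module.Basis.ofVectorSpace ℂ N
  apply (TensorProduct.equivFinsuppOfBasisRight b).injective
  ext i
  rw [TensorProduct.equivFinsuppOfBasisRight_apply, map_zero, Finsupp.zero_apply]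
  exact h (b.coord i)

lemma exists_comp_eq_of_ker {V W U : Type} [AddCommGroup V] [Module ℂ V] [AddCommGroup W]
    [Module ℂ W] [AddCommGroup U] [Module ℂ U] (T : V →ₗ[ℂ] W) (G : V →ₗ[ℂ] U)
    (h : ∀ z, T z = 0 → G z = 0) : ∃ R : W →ₗ[ℂ] U, ∀ z, R (T z) = G z := by
  obtain ⟨s, hs⟩ := T.rangeRestrict.exists_rightInverse_of_surjective T.range_rangeRestrict
  obtain ⟨σ, hσ⟩ := s.exists_extend
  refine ⟨G ∘ₗ σ, fun z => ?_⟩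
  have h1 : σ (T z) = s (T.rangeRestrict z) := by rw [← hσ]; rfl
  have h2 : T (s (T.rangeRestrict z)) = T z :=
    congrArg Subtype.val (LinearMap.congr_fun hs (T.rangeRestrict z))
  rw [LinearMap.comp_apply, h1, ← sub_eq_zero, ← map_sub]
  exact h _ (by rw [map_sub, h2, sub_self])

end Slices

/-- A coproduct on a unital algebra with `Δ 1 = ∑ e i ⊗ f i`, the images `e' i` and `f' i` of
`f i` and `e i` under the antipodal maps, a family `Φ` of left integrals and a family `Ψ` of
right integrals. -/
structure IntegralData (A : Type) [Ring A] [Algebra ℂ A] where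
  Δ : A →ₗ[ℂ] A ⊗[ℂ] A
  n : ℕ
  (e f e' f' : Fin n → A)
  (Φ Ψ : Set (A →ₗ[ℂ] ℂ))
  l : A →ₗ[ℂ] ℂ
  map_mul : ∀ a b, Δ (a * b) = Δ a * Δ b
  coassoc : ∀ a, TensorProduct.assoc ℂ A A A (LinearMap.rTensor A Δ (Δ a)) =
    LinearMap.lTensor A Δ (Δ a)
  map_one : Δ 1 = ∑ i, e i ⊗ₜ[ℂ] f i
  map_e_mul : ∀ i x, Δ (e i * x) = (1 ⊗ₜ[ℂ] e i) * Δ x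
  map_mul_e : ∀ i x, Δ (x * e i) = Δ x * (1 ⊗ₜ[ℂ] e i)
  map_mul_f : ∀ i x, Δ (x * f i) = Δ x * (f i ⊗ₜ[ℂ] 1)
  map_one_mul_e : ∀ i, Δ 1 * (e i ⊗ₜ[ℂ] 1) = Δ 1 * (1 ⊗ₜ[ℂ] f' i)
  sum_e_mul_e' : ∑ i, e i * e' i = 1
  sum_f'_e' : ∀ ω : A →ₗ[ℂ] ℂ, ∑ i, ω (f' i) • e' i = ∑ i, ω (f i) • e i
  left_integral : ∀ φ ∈ Φ, ∀ a, sL φ (Δ a) = ∑ i, φ (f i * a) • f' i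
  l_left_integral : ∀ φ ∈ Φ, ∀ a, l (sL φ (Δ a)) = φ a
  right_integral : ∀ ψ ∈ Ψ, ∀ a, sR ψ (Δ a) = ∑ i, ψ (a * e i) • e' i
  faithful_left : ∀ a, (∀ φ ∈ Φ, ∀ b, φ (a * b) = 0) → a = 0
  faithful_right : ∀ a, (∀ ψ ∈ Ψ, ∀ b, ψ (b * a) = 0) → a = 0
  full : Submodule.span ℂ {x : A | ∃ ω : A →ₗ[ℂ] ℂ, ∃ a : A, x = sL ω (Δ a)} = ⊤

namespace IntegralData

variable {A : Type} [Ring A] [Algebra ℂ A] (D : IntegralData A)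

lemma one_mul_map (a : A) : D.Δ 1 * D.Δ a = D.Δ a := by rw [← D.map_mul, one_mul]

lemma map_mul_one (a : A) : D.Δ a * D.Δ 1 = D.Δ a := by rw [← D.map_mul, mul_one]

lemma ext_of_full {W : Type} [AddCommGroup W] [Module ℂ W] (X Y : A →ₗ[ℂ] W)
    (h : ∀ ω a, X (sL ω (D.Δ a)) = Y (sL ω (D.Δ a))) : X = Y := by
  apply LinearMap.ext_on D.full
  rintro _ ⟨ω, a, rfl⟩
  exact h ω a

lemma ext_of_faithful {W : Type} [AddCommGroup W] [Module ℂ W] (X Y : A →ₗ[ℂ] W)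
    (h : ∀ φ ∈ D.Φ, ∀ a b, X (sL φ (D.Δ a * (1 ⊗ₜ[ℂ] b))) = Y (sL φ (D.Δ a * (1 ⊗ₜ[ℂ] b)))) :
    X = Y := by
  ext x
  rw [← sub_eq_zero, ← LinearMap.sub_apply, ← Module.forall_dual_apply_eq_zero_iff ℂ]
  intro g
  suffices g ∘ₗ (X - Y) = 0 from LinearMap.congr_fun this x
  apply D.ext_of_full
  intro θ a
  rw [apply_sL_eq_apply_sR, LinearMap.zero_apply]
  convert map_zero θ
  apply D.faithful_left
  intro φ hφ b
  rw [← sR_mul_one_tmul, ← apply_sL_eq_apply_sR]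
  simp [h φ hφ]

/-- The canonical map `p ⊗ q ↦ Δ p * (1 ⊗ q)`. -/
noncomputable def T : A ⊗[ℂ] A →ₗ[ℂ] A ⊗[ℂ] A :=
  LinearMap.mul' ℂ (A ⊗[ℂ] A) ∘ₗ TensorProduct.map D.Δ (TensorProduct.mk ℂ A A 1)

@[simp]
lemma T_tmul (p q : A) : D.T (p ⊗ₜ[ℂ] q) = D.Δ p * (1 ⊗ₜ[ℂ] q) := by simp [T]

/-- The map `p ⊗ q ↦ ∑ i, p * e i ⊗ e' i * q`, whose kernel is that of `T`. -/
noncomputable def G : A ⊗[ℂ] A →ₗ[ℂ] A ⊗[ℂ] A :=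
  ∑ i, TensorProduct.map (LinearMap.mulRight ℂ (D.e i)) (LinearMap.mulLeft ℂ (D.e' i))

@[simp]
lemma G_tmul (p q : A) : D.G (p ⊗ₜ[ℂ] q) = ∑ i, (p * D.e i) ⊗ₜ[ℂ] (D.e' i * q) := by simp [G]

lemma G_eq_zero (z : A ⊗[ℂ] A) (hz : D.T z = 0) : D.G z = 0 := by
  apply eq_zero_of_sL_eq_zero
  intro ω
  apply D.faithful_right
  intro ψ hψ p
  have key : ∀ z, sR ψ (D.Δ p * D.T z) = sR (ψ ∘ₗ LinearMap.mulLeft ℂ p) (D.G z) := by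
    intro z
    induction z with
    | zero => simp
    | tmul u q =>
      rw [T_tmul, ← mul_assoc, ← D.map_mul, sR_mul_one_tmul, D.right_integral ψ hψ]
      simp [Finset.sum_mul, mul_assoc]
    | add x y hx hy => simp [mul_add, hx, hy]
  have h := apply_sL_eq_apply_sR (ψ ∘ₗ LinearMap.mulLeft ℂ p) ω (D.G z)
  rw [← key, hz] at h
  simpa using h

/-- A left inverse of `T` modulo its kernel. -/
noncomputable def R : A ⊗[ℂ] A →ₗ[ℂ] A ⊗[ℂ] A :=
  (exists_comp_eq_of_ker D.T D.G D.G_eq_zero).choose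

@[simp]
lemma R_T (z : A ⊗[ℂ] A) : D.R (D.T z) = D.G z :=
  (exists_comp_eq_of_ker D.T D.G D.G_eq_zero).choose_spec z

lemma T_mul (z : A ⊗[ℂ] A) (q : A) : D.T z * (1 ⊗ₜ[ℂ] q) = D.T (z * (1 ⊗ₜ[ℂ] q)) := by
  induction z with
  | zero => simp
  | tmul u v => simp [mul_assoc]
  | add x y hx hy => simp [add_mul, hx, hy]

lemma mul_T (z : A ⊗[ℂ] A) (a : A) : D.Δ a * D.T z = D.T ((a ⊗ₜ[ℂ] 1) * z) := by
  induction z with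
  | zero => simp
  | tmul u v => simp [← mul_assoc, D.map_mul]
  | add x y hx hy => simp [mul_add, hx, hy]

lemma one_mul_T (z : A ⊗[ℂ] A) : D.Δ 1 * D.T z = D.T z := by
  rw [mul_T, ← Algebra.TensorProduct.one_def, one_mul]

/-- The map `v ↦ (id ⊗ φ)((1 ⊗ v) * Δ b)`. -/
noncomputable def g (φ : A →ₗ[ℂ] ℂ) (b : A) : A →ₗ[ℂ] A :=
  sL φ ∘ₗ LinearMap.mulRight ℂ (D.Δ b) ∘ₗ TensorProduct.mk ℂ A A 1

lemma g_apply (φ : A →ₗ[ℂ] ℂ) (b v : A) : D.g φ b v = sL φ ((1 ⊗ₜ[ℂ] v) * D.Δ b) := rfl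

lemma T_lTensor_g (φ : A →ₗ[ℂ] ℂ) (a b : A) :
    D.T (LinearMap.lTensor A (D.g φ b) (D.Δ a)) =
      LinearMap.lTensor A (sL φ ∘ₗ LinearMap.mulRight ℂ (D.Δ b))
        (LinearMap.lTensor A D.Δ (D.Δ a)) := by
  rw [← D.coassoc]
  induction D.Δ a with
  | zero => simp
  | add x y hx hy => simp [hx, hy]
  | tmul u v =>
    simp only [LinearMap.lTensor_tmul, LinearMap.rTensor_tmul, T_tmul]
    induction D.Δ u with
    | zero => simp
    | add x y hx hy => simp [TensorProduct.add_tmul, add_mul, hx, hy]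
    | tmul x y =>
      simp only [TensorProduct.assoc_tmul, LinearMap.lTensor_tmul, g_apply,
        Algebra.TensorProduct.tmul_mul_tmul, mul_one, LinearMap.comp_apply,
        LinearMap.mulRight_apply]
      rw [← sL_tmul_one_mul, ← mul_assoc]
      simp

lemma T_lTensor_g_eq {φ : A →ₗ[ℂ] ℂ} (hφ : φ ∈ D.Φ) (a b : A) :
    D.T (LinearMap.lTensor A (D.g φ b) (D.Δ a)) =
      D.Δ 1 * (sL φ (D.Δ a * (1 ⊗ₜ[ℂ] b)) ⊗ₜ[ℂ] 1) := by
  have h1 : ∀ t : A ⊗[ℂ] A, LinearMap.lTensor A (sL φ ∘ₗ LinearMap.mulRight ℂ (D.Δ b))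
        (LinearMap.lTensor A D.Δ t) =
        ∑ i, (sL φ ((1 ⊗ₜ[ℂ] D.f i) * t * (1 ⊗ₜ[ℂ] b)) ⊗ₜ[ℂ] D.f' i) := by
    intro t
    induction t with
    | zero => simp
    | add x y hx hy =>
      simp [hx, hy, mul_add, add_mul, Finset.sum_add_distrib, TensorProduct.add_tmul]
    | tmul u v =>
      simp [← D.map_mul, D.left_integral φ hφ, TensorProduct.tmul_sum, mul_assoc,
        TensorProduct.smul_tmul]
  have h2 : ∀ i (x : A), D.Δ 1 * (x ⊗ₜ[ℂ] D.f' i) = D.Δ 1 * ((D.e i * x) ⊗ₜ[ℂ] 1) := by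
    intro i x
    have h : ∀ y : A, x ⊗ₜ[ℂ] y = (1 ⊗ₜ[ℂ] y) * (x ⊗ₜ[ℂ] 1) := by simp
    rw [h, ← mul_assoc, ← D.map_one_mul_e, mul_assoc]
    simp
  rw [← D.one_mul_T, T_lTensor_g, h1, Finset.mul_sum]
  simp only [h2]
  rw [← Finset.mul_sum, ← TensorProduct.sum_tmul]
  congr 2
  conv_rhs => rw [← D.one_mul_map a, D.map_one, Finset.sum_mul, Finset.sum_mul, map_sum]
  refine Finset.sum_congr rfl fun i _ => ?_
  rw [← sL_tmul_one_mul, ← mul_assoc, ← mul_assoc]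
  simp

end IntegralData
namespace IntegralData

variable {A : Type} [Ring A] [Algebra ℂ A] (D : IntegralData A)

lemma exists_T_eq (z : A ⊗[ℂ] A) : ∃ w, D.T w = D.Δ 1 * z := by
  suffices h : ∀ x, D.Δ 1 * (x ⊗ₜ[ℂ] 1) ∈ LinearMap.range D.T by
    induction z with
    | zero => exact ⟨0, by simp⟩
    | tmul x y =>
      obtain ⟨w, hw⟩ := h x
      refine ⟨w * (1 ⊗ₜ[ℂ] y), ?_⟩
      rw [← D.T_mul, hw, mul_assoc]
      simp
    | add x y hx hy =>
      obtain ⟨u, hu⟩ := hx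
      obtain ⟨v, hv⟩ := hy
      exact ⟨u + v, by rw [map_add, hu, hv, mul_add]⟩
  intro x
  rw [← Submodule.Quotient.mk_eq_zero]
  have := D.ext_of_faithful ((LinearMap.range D.T).mkQ ∘ₗ LinearMap.mulLeft ℂ (D.Δ 1) ∘ₗ
    (TensorProduct.mk ℂ A A).flip 1) 0 (by
      intro φ hφ a b
      have : D.Δ 1 * (sL φ (D.Δ a * (1 ⊗ₜ[ℂ] b)) ⊗ₜ[ℂ] 1) ∈ LinearMap.range D.T :=
        ⟨_, D.T_lTensor_g_eq hφ a b⟩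
      simpa using this)
  simpa using LinearMap.congr_fun this x

/-- The counit. -/
noncomputable def ε : A →ₗ[ℂ] ℂ :=
  D.l ∘ₗ LinearMap.mul' ℂ A ∘ₗ D.R ∘ₗ LinearMap.mulLeft ℂ (D.Δ 1) ∘ₗ
    (TensorProduct.mk ℂ A A).flip 1

lemma mul'_G (z : A ⊗[ℂ] A) : LinearMap.mul' ℂ A (D.G z) = LinearMap.mul' ℂ A z := by
  induction z with
  | zero => simp
  | add x y hx hy => simp only [map_add, hx, hy]
  | tmul x y =>
    have h : ∀ i, x * D.e i * (D.e' i * y) = x * (D.e i * D.e' i) * y := by simp [mul_assoc]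
    simp only [G_tmul, map_sum, LinearMap.mul'_apply, h]
    rw [← Finset.sum_mul, ← Finset.mul_sum, D.sum_e_mul_e', mul_one]

lemma mul'_lTensor_g (φ : A →ₗ[ℂ] ℂ) (a b : A) :
    LinearMap.mul' ℂ A (LinearMap.lTensor A (D.g φ b) (D.Δ a)) = sL φ (D.Δ (a * b)) := by
  rw [D.map_mul]
  induction D.Δ a with
  | zero => simp
  | add x y hx hy => simp [add_mul, hx, hy]
  | tmul u v =>
    rw [LinearMap.lTensor_tmul, LinearMap.mul'_apply, g_apply, ← sL_tmul_one_mul, ← mul_assoc]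
    simp

lemma ε_sL {φ : A →ₗ[ℂ] ℂ} (hφ : φ ∈ D.Φ) (a b : A) :
    D.ε (sL φ (D.Δ a * (1 ⊗ₜ[ℂ] b))) = φ (a * b) := by
  have h := D.T_lTensor_g_eq hφ a b
  simp only [ε, LinearMap.comp_apply, LinearMap.flip_apply, TensorProduct.mk_apply,
    LinearMap.mulLeft_apply]
  rw [← h, R_T, mul'_G, mul'_lTensor_g, D.l_left_integral φ hφ]

@[simp]
lemma sR_ε (a : A) : sR D.ε (D.Δ a) = a := by
  rw [← sub_eq_zero]
  apply D.faithful_left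
  intro φ hφ b
  rw [sub_mul, map_sub, ← sR_mul_one_tmul, ← apply_sL_eq_apply_sR, D.ε_sL hφ, sub_self]

@[simp]
lemma sL_ε (a : A) : sL D.ε (D.Δ a) = a := by
  suffices sL D.ε ∘ₗ D.Δ = LinearMap.id from LinearMap.congr_fun this a
  apply D.ext_of_full
  intro ω a
  let N : A ⊗[ℂ] (A ⊗[ℂ] A) →ₗ[ℂ] A := sL (ω ∘ₗ sR D.ε)
  have h1 : ∀ t : A ⊗[ℂ] A, N (LinearMap.lTensor A D.Δ t) = sL ω t := by
    intro t
    induction t with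
    | zero => simp
    | add x y hx hy => simp [hx, hy]
    | tmul u v => simp [N]
  have h2 : ∀ t : A ⊗[ℂ] A, N (TensorProduct.assoc ℂ A A A (LinearMap.rTensor A D.Δ t)) =
      sL D.ε (D.Δ (sL ω t)) := by
    intro t
    induction t with
    | zero => simp
    | add x y hx hy => simp [hx, hy]
    | tmul u v =>
      simp only [LinearMap.rTensor_tmul, sL_tmul, map_smul]
      induction D.Δ u with
      | zero => simp
      | add x y hx hy => simp [TensorProduct.add_tmul, hx, hy]
      | tmul x y => simp [N, smul_smul, mul_comm]
  rw [LinearMap.comp_apply, LinearMap.id_apply, ← h2, D.coassoc, h1]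

lemma ε_mul_e (p : A) (i : Fin D.n) : D.ε (p * D.e i) = D.ε (p * D.f' i) := by
  have h : D.Δ p * (D.e i ⊗ₜ[ℂ] 1) = D.Δ p * (1 ⊗ₜ[ℂ] D.f' i) := by
    rw [← D.map_mul_one, mul_assoc, D.map_one_mul_e, mul_assoc]
  have := congrArg (fun z => D.ε (sL D.ε z)) h
  simp only [sL_mul_tmul_one, sL_ε] at this
  rw [this, apply_sL_eq_apply_sR, sR_mul_one_tmul, sR_ε]

/-- The source map `p ↦ ∑ i, ε (p * f i) • e i`. -/
noncomputable def es : A →ₗ[ℂ] A :=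
  ∑ i, (D.ε ∘ₗ LinearMap.mulRight ℂ (D.f i)).smulRight (D.e i)

lemma es_apply (p : A) : D.es p = ∑ i, D.ε (p * D.f i) • D.e i := by simp [es]

lemma es_apply' (p : A) : D.es p = ∑ i, D.ε (p * D.e i) • D.e' i := by
  have := D.sum_f'_e' (D.ε ∘ₗ LinearMap.mulLeft ℂ p)
  simp only [LinearMap.comp_apply, LinearMap.mulLeft_apply] at this
  simp only [es_apply, ← this, ε_mul_e]

/-- The map with `P (Δ p * (1 ⊗ q)) = es p * q`. -/
noncomputable def P : A ⊗[ℂ] A →ₗ[ℂ] A := sR D.ε ∘ₗ D.R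

@[simp]
lemma P_map_mul (p q : A) : D.P (D.Δ p * (1 ⊗ₜ[ℂ] q)) = D.es p * q := by
  rw [P, ← T_tmul, LinearMap.comp_apply, R_T]
  simp [es_apply', Finset.sum_mul]

@[simp]
lemma P_map (p : A) : D.P (D.Δ p) = D.es p := by
  simpa [← Algebra.TensorProduct.one_def] using D.P_map_mul p 1

/-- The antipode. -/
noncomputable def S : A →ₗ[ℂ] A :=
  D.P ∘ₗ LinearMap.mulLeft ℂ (D.Δ 1) ∘ₗ (TensorProduct.mk ℂ A A).flip 1

lemma S_apply (x : A) : D.S x = D.P (D.Δ 1 * (x ⊗ₜ[ℂ] 1)) := rfl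

lemma P_mul (z : A ⊗[ℂ] A) (q : A) :
    D.P (D.Δ 1 * z * (1 ⊗ₜ[ℂ] q)) = D.P (D.Δ 1 * z) * q := by
  obtain ⟨w, hw⟩ := D.exists_T_eq z
  rw [← hw]
  clear hw
  induction w with
  | zero => simp
  | add x y hx hy => simp only [map_add, add_mul, hx, hy]
  | tmul x y => rw [T_mul]; simp [mul_assoc]

lemma P_one_mul_tmul (x q : A) : D.P (D.Δ 1 * (x ⊗ₜ[ℂ] q)) = D.S x * q := by
  rw [S_apply, ← P_mul, mul_assoc]
  simp

lemma mul'_map_S (z : A ⊗[ℂ] A) :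
    LinearMap.mul' ℂ A (TensorProduct.map D.S LinearMap.id z) = D.P (D.Δ 1 * z) := by
  induction z with
  | zero => simp
  | add x y hx hy => simp only [map_add, mul_add, hx, hy]
  | tmul x y => simp [P_one_mul_tmul]

lemma mul'_map_S_map (a : A) :
    LinearMap.mul' ℂ A (TensorProduct.map D.S LinearMap.id (D.Δ a)) =
      sL D.ε ((1 ⊗ₜ[ℂ] a) * D.Δ 1) := by
  rw [mul'_map_S, one_mul_map, P_map, es_apply, D.map_one, Finset.mul_sum]
  simp

lemma S_eq (x : A) :
    D.S x = LinearMap.mul' ℂ A (TensorProduct.map D.S LinearMap.id (D.Δ 1 * (x ⊗ₜ[ℂ] 1))) := by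
  rw [mul'_map_S, ← mul_assoc, one_mul_map, S_apply]

lemma S_sL {φ : A →ₗ[ℂ] ℂ} (hφ : φ ∈ D.Φ) (a b : A) :
    D.S (sL φ (D.Δ a * (1 ⊗ₜ[ℂ] b))) = sL φ ((1 ⊗ₜ[ℂ] a) * D.Δ b) := by
  rw [S_apply, ← D.T_lTensor_g_eq hφ]
  have h1 : ∀ t : A ⊗[ℂ] A, D.P (D.T (LinearMap.lTensor A (D.g φ b) t)) =
      ∑ i, sL φ ((D.e i ⊗ₜ[ℂ] sR D.ε (t * (D.f i ⊗ₜ[ℂ] 1))) * D.Δ b) := by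
    intro t
    induction t with
    | zero => simp
    | add x y hx hy =>
      simp only [map_add, hx, hy, add_mul, TensorProduct.tmul_add, Finset.sum_add_distrib]
    | tmul u v =>
      simp only [LinearMap.lTensor_tmul, T_tmul, P_map_mul, es_apply, Finset.sum_mul, g_apply]
      refine Finset.sum_congr rfl fun i _ => ?_
      rw [smul_mul_assoc, ← sL_tmul_one_mul, ← mul_assoc]
      simp
  rw [h1]
  conv_rhs => rw [← D.one_mul_map b, ← mul_assoc, D.map_one, Finset.mul_sum, Finset.sum_mul,
    map_sum]
  simp [← D.map_mul_f]

lemma sR_ε_T (w : A ⊗[ℂ] A) : sR D.ε (D.T w) = LinearMap.mul' ℂ A w := by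
  induction w with
  | zero => simp
  | add x y hx hy => simp only [map_add, hx, hy]
  | tmul p q => simp [sR_mul_one_tmul]

lemma mul'_lTensor_es (p : A) : LinearMap.mul' ℂ A (LinearMap.lTensor A D.es (D.Δ p)) = p := by
  have h : ∀ t : A ⊗[ℂ] A, LinearMap.mul' ℂ A (LinearMap.lTensor A D.es t) =
      ∑ i, sL D.ε (t * (1 ⊗ₜ[ℂ] D.e i)) * D.e' i := by
    intro t
    induction t with
    | zero => simp
    | add x y hx hy => simp only [map_add, add_mul, hx, hy, Finset.sum_add_distrib]
    | tmul u v => simp [es_apply', Finset.mul_sum]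
  rw [h]
  simp only [← D.map_mul_e, sL_ε, mul_assoc]
  rw [← Finset.mul_sum, D.sum_e_mul_e', mul_one]

/-- The map `a ⊗ q ↦ m ((id ⊗ S) (Δ a)) * q`. -/
noncomputable def M : A ⊗[ℂ] A →ₗ[ℂ] A :=
  LinearMap.mul' ℂ A ∘ₗ LinearMap.rTensor A
    (LinearMap.mul' ℂ A ∘ₗ TensorProduct.map LinearMap.id D.S ∘ₗ D.Δ)

lemma M_tmul (a q : A) : D.M (a ⊗ₜ[ℂ] q) =
    LinearMap.mul' ℂ A (TensorProduct.map LinearMap.id D.S (D.Δ a)) * q := by simp [M]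

lemma M_mul (z : A ⊗[ℂ] A) (q : A) : D.M (z * (1 ⊗ₜ[ℂ] q)) = D.M z * q := by
  induction z with
  | zero => simp
  | add x y hx hy => simp only [map_add, add_mul, hx, hy]
  | tmul x y => simp [M_tmul, mul_assoc]

lemma M_map (p : A) : D.M (D.Δ p) = p := by
  let J : A ⊗[ℂ] (A ⊗[ℂ] A) →ₗ[ℂ] A := LinearMap.mul' ℂ A ∘ₗ LinearMap.lTensor A
    (LinearMap.mul' ℂ A ∘ₗ TensorProduct.map D.S LinearMap.id)
  have h1 : ∀ t : A ⊗[ℂ] A, D.M t =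
      J (TensorProduct.assoc ℂ A A A (LinearMap.rTensor A D.Δ t)) := by
    intro t
    induction t with
    | zero => simp
    | add x y hx hy => simp only [map_add, hx, hy]
    | tmul u v =>
      simp only [M_tmul, LinearMap.rTensor_tmul]
      induction D.Δ u with
      | zero => simp
      | add x y hx hy => simp only [map_add, TensorProduct.add_tmul, add_mul, hx, hy]
      | tmul x y => simp [J, mul_assoc]
  have h2 : ∀ t : A ⊗[ℂ] A, J (LinearMap.lTensor A D.Δ t) =
      LinearMap.mul' ℂ A (LinearMap.lTensor A D.es t) := by
    intro t
    induction t with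
    | zero => simp
    | add x y hx hy => simp only [map_add, hx, hy]
    | tmul u v => simp [J, mul'_map_S, one_mul_map]
  rw [h1, D.coassoc, h2, mul'_lTensor_es]

lemma M_T (w : A ⊗[ℂ] A) : D.M (D.T w) = LinearMap.mul' ℂ A w := by
  induction w with
  | zero => simp
  | add x y hx hy => simp only [map_add, hx, hy]
  | tmul p q => simp [M_mul, M_map]

lemma mul'_map_id_S_map (a : A) :
    LinearMap.mul' ℂ A (TensorProduct.map LinearMap.id D.S (D.Δ a)) =
      sR D.ε (D.Δ 1 * (a ⊗ₜ[ℂ] 1)) := by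
  obtain ⟨w, hw⟩ := D.exists_T_eq (a ⊗ₜ[ℂ] 1)
  rw [← hw, sR_ε_T, ← D.M_T w, hw, D.map_one, Finset.sum_mul, map_sum]
  simp only [Algebra.TensorProduct.tmul_mul_tmul, mul_one, M_tmul, D.map_e_mul]
  induction D.Δ a with
  | zero => simp
  | add x y hx hy => simp only [map_add, add_mul, mul_add, hx, hy, Finset.sum_add_distrib]
  | tmul u v =>
    simp only [TensorProduct.map_tmul, LinearMap.mul'_apply, LinearMap.id_apply,
      Algebra.TensorProduct.tmul_mul_tmul, one_mul, mul_assoc]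
    rw [← Finset.mul_sum]
    congr 1
    conv_lhs => rw [S_eq, D.map_one]
    simp [Finset.sum_mul]

lemma ε_mul (p x : A) : D.ε (p * x) = D.ε (D.es p * x) := by
  have h1 : D.ε (D.es p * x) = D.ε (p * sR D.ε (D.Δ 1 * (x ⊗ₜ[ℂ] 1))) := by
    simp [D.map_one, es_apply, Finset.sum_mul, Finset.mul_sum, mul_comm]
  have h2 : p * sR D.ε (D.Δ 1 * (x ⊗ₜ[ℂ] 1)) = sR D.ε (D.Δ p * (x ⊗ₜ[ℂ] 1)) := by
    obtain ⟨w, hw⟩ := D.exists_T_eq (x ⊗ₜ[ℂ] 1)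
    rw [← D.map_mul_one p, mul_assoc, ← hw, mul_T, sR_ε_T, sR_ε_T]
    clear hw
    induction w with
    | zero => simp
    | add x y hx hy => simp only [map_add, mul_add, hx, hy]
    | tmul p q => simp [mul_assoc]
  rw [h1, h2, ← apply_sL_eq_apply_sR, sL_mul_tmul_one, sL_ε]

lemma es_mul (p r : A) : D.es (p * r) = D.es (D.es p * r) := by
  rw [es_apply, D.es_apply (D.es p * r)]
  refine Finset.sum_congr rfl fun i _ => ?_
  rw [mul_assoc, ε_mul, ← mul_assoc]

lemma map_es_mul (p x : A) : D.Δ (D.es p * x) = (1 ⊗ₜ[ℂ] D.es p) * D.Δ x := by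
  simp [es_apply, Finset.sum_mul, TensorProduct.tmul_sum, D.map_e_mul]

lemma map_es (p : A) : (1 ⊗ₜ[ℂ] D.es p) * D.Δ 1 = D.Δ 1 * (1 ⊗ₜ[ℂ] D.es p) := by
  rw [← map_es_mul, mul_one]
  simp only [es_apply, TensorProduct.tmul_sum, Finset.mul_sum, map_sum,
    map_smul, TensorProduct.tmul_smul, mul_smul_comm, ← D.map_mul_e, one_mul]

lemma P_map_mul_one_mul (p : A) (z : A ⊗[ℂ] A) :
    D.P (D.Δ p * (D.Δ 1 * z)) = D.P ((1 ⊗ₜ[ℂ] D.es p) * (D.Δ 1 * z)) := by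
  obtain ⟨w, hw⟩ := D.exists_T_eq z
  rw [← hw]
  clear hw
  induction w with
  | zero => simp
  | add x y hx hy => simp only [map_add, mul_add, hx, hy]
  | tmul r s =>
    rw [T_tmul, ← mul_assoc, ← D.map_mul, ← mul_assoc, ← map_es_mul, P_map_mul, P_map_mul, es_mul]

lemma P_mul_tmul_one (z : A ⊗[ℂ] A) (b : A) :
    D.P (D.Δ 1 * z * (b ⊗ₜ[ℂ] 1)) = D.S b * D.P (D.Δ 1 * z) := by
  obtain ⟨w, hw⟩ := D.exists_T_eq z
  rw [← hw]
  clear hw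
  induction w with
  | zero => simp
  | add x y hx hy => simp only [map_add, mul_add, add_mul, hx, hy]
  | tmul p q =>
    rw [T_tmul, P_map_mul, ← P_one_mul_tmul, ← D.map_mul_one p, mul_assoc, mul_assoc,
      P_map_mul_one_mul, ← mul_assoc, map_es, mul_assoc]
    simp

lemma S_mul (a b : A) : D.S (a * b) = D.S b * D.S a := by
  rw [S_apply, D.S_apply a, ← P_mul_tmul_one, mul_assoc]
  simp

end IntegralData
namespace IntegralData

variable {A : Type} [Ring A] [Algebra ℂ A] (D : IntegralData A)

/-- The canonical map `A ⊗ A → Aᵐᵒᵖ ⊗ Aᵐᵒᵖ`. -/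
noncomputable def opT (A : Type) [Ring A] [Algebra ℂ A] : A ⊗[ℂ] A →ₗ[ℂ] Aᵐᵒᵖ ⊗[ℂ] Aᵐᵒᵖ :=
  TensorProduct.map (MulOpposite.opLinearEquiv ℂ).toLinearMap
    (MulOpposite.opLinearEquiv ℂ).toLinearMap

@[simp]
lemma opT_tmul (x y : A) : opT A (x ⊗ₜ[ℂ] y) = MulOpposite.op x ⊗ₜ[ℂ] MulOpposite.op y := rfl

lemma opT_mul (z w : A ⊗[ℂ] A) : opT A (z * w) = opT A w * opT A z := by
  induction z with
  | zero => simp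
  | add x y hx hy => simp [add_mul, mul_add, hx, hy]
  | tmul x y =>
    induction w with
    | zero => simp
    | add u v hu hv => simp [add_mul, mul_add, hu, hv]
    | tmul u v => simp

lemma sL_opT (φ : Aᵐᵒᵖ →ₗ[ℂ] ℂ) (z : A ⊗[ℂ] A) :
    sL φ (opT A z) =
      MulOpposite.op (sL (φ ∘ₗ (MulOpposite.opLinearEquiv ℂ).toLinearMap) z) := by
  induction z with
  | zero => simp
  | add x y hx hy => simp [hx, hy]
  | tmul x y => simp

lemma sR_opT (φ : Aᵐᵒᵖ →ₗ[ℂ] ℂ) (z : A ⊗[ℂ] A) :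
    sR φ (opT A z) =
      MulOpposite.op (sR (φ ∘ₗ (MulOpposite.opLinearEquiv ℂ).toLinearMap) z) := by
  induction z with
  | zero => simp
  | add x y hx hy => simp [hx, hy]
  | tmul x y => simp

/-- The coproduct of the opposite algebra. -/
noncomputable def opΔ : Aᵐᵒᵖ →ₗ[ℂ] Aᵐᵒᵖ ⊗[ℂ] Aᵐᵒᵖ :=
  opT A ∘ₗ D.Δ ∘ₗ (MulOpposite.opLinearEquiv ℂ).symm.toLinearMap

@[simp]
lemma opΔ_op (x : A) : D.opΔ (MulOpposite.op x) = opT A (D.Δ x) := rfl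

lemma opΔ_coassoc (a : Aᵐᵒᵖ) :
    TensorProduct.assoc ℂ Aᵐᵒᵖ Aᵐᵒᵖ Aᵐᵒᵖ (LinearMap.rTensor Aᵐᵒᵖ D.opΔ (D.opΔ a)) =
      LinearMap.lTensor Aᵐᵒᵖ D.opΔ (D.opΔ a) := by
  induction a using MulOpposite.rec' with | _ a
  let Q : A ⊗[ℂ] (A ⊗[ℂ] A) →ₗ[ℂ] Aᵐᵒᵖ ⊗[ℂ] (Aᵐᵒᵖ ⊗[ℂ] Aᵐᵒᵖ) :=
    TensorProduct.map (MulOpposite.opLinearEquiv ℂ).toLinearMap (opT A)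
  have h1 : ∀ t : A ⊗[ℂ] A, LinearMap.lTensor Aᵐᵒᵖ D.opΔ (opT A t) =
      Q (LinearMap.lTensor A D.Δ t) := by
    intro t
    induction t with
    | zero => simp
    | add x y hx hy => simp only [map_add, hx, hy]
    | tmul u v => simp [Q]
  have h2 : ∀ t : A ⊗[ℂ] A, TensorProduct.assoc ℂ Aᵐᵒᵖ Aᵐᵒᵖ Aᵐᵒᵖ
      (LinearMap.rTensor Aᵐᵒᵖ D.opΔ (opT A t)) =
      Q (TensorProduct.assoc ℂ A A A (LinearMap.rTensor A D.Δ t)) := by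
    intro t
    induction t with
    | zero => simp
    | add x y hx hy => simp only [map_add, hx, hy]
    | tmul u v =>
      simp only [opT_tmul, LinearMap.rTensor_tmul, opΔ_op]
      induction D.Δ u with
      | zero => simp
      | add x y hx hy => simp only [map_add, TensorProduct.add_tmul, hx, hy]
      | tmul x y => simp [Q]
  rw [opΔ_op, h1, h2, D.coassoc]

/-- The integral data on the opposite algebra. -/
noncomputable def op (e'' f'' : Fin D.n → A)
    (map_f_mul : ∀ i x, D.Δ (D.f i * x) = (D.f i ⊗ₜ[ℂ] 1) * D.Δ x)
    (e_mul_map_one : ∀ i, (D.e i ⊗ₜ[ℂ] 1) * D.Δ 1 = (1 ⊗ₜ[ℂ] f'' i) * D.Δ 1)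
    (sum_e''_mul_e : ∑ i, e'' i * D.e i = 1)
    (sum_f''_e'' : ∀ ω : A →ₗ[ℂ] ℂ, ∑ i, ω (f'' i) • e'' i = ∑ i, ω (D.f i) • D.e i)
    (left_integral : ∀ φ ∈ D.Φ, ∀ a, sL φ (D.Δ a) = ∑ i, φ (a * D.f i) • f'' i)
    (right_integral : ∀ ψ ∈ D.Ψ, ∀ a, sR ψ (D.Δ a) = ∑ i, ψ (D.e i * a) • e'' i)
    (faithful_left : ∀ a, (∀ φ ∈ D.Φ, ∀ b, φ (b * a) = 0) → a = 0)
    (faithful_right : ∀ a, (∀ ψ ∈ D.Ψ, ∀ b, ψ (a * b) = 0) → a = 0) : IntegralData Aᵐᵒᵖ where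
  Δ := D.opΔ
  n := D.n
  e := fun i => MulOpposite.op (D.e i)
  f := fun i => MulOpposite.op (D.f i)
  e' := fun i => MulOpposite.op (e'' i)
  f' := fun i => MulOpposite.op (f'' i)
  Φ := {φ | φ ∘ₗ (MulOpposite.opLinearEquiv ℂ).toLinearMap ∈ D.Φ}
  Ψ := {φ | φ ∘ₗ (MulOpposite.opLinearEquiv ℂ).toLinearMap ∈ D.Ψ}
  l := D.l ∘ₗ (MulOpposite.opLinearEquiv ℂ).symm.toLinearMap
  map_mul := by
    intro a b
    induction a using MulOpposite.rec' with | _ a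
    induction b using MulOpposite.rec' with | _ b
    rw [← MulOpposite.op_mul, opΔ_op, D.map_mul, opT_mul]
    rfl
  coassoc := D.opΔ_coassoc
  map_one := by
    rw [← MulOpposite.op_one, opΔ_op, D.map_one]
    simp
  map_e_mul := by
    intro i x
    induction x using MulOpposite.rec' with | _ x
    rw [← MulOpposite.op_mul, opΔ_op, D.map_mul_e, opT_mul]
    rfl
  map_mul_e := by
    intro i x
    induction x using MulOpposite.rec' with | _ x
    rw [← MulOpposite.op_mul, opΔ_op, D.map_e_mul, opT_mul]
    rfl
  map_mul_f := by
    intro i x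
    induction x using MulOpposite.rec' with | _ x
    rw [← MulOpposite.op_mul, opΔ_op, map_f_mul, opT_mul]
    rfl
  map_one_mul_e := by
    intro i
    have := congrArg (opT A) (e_mul_map_one i)
    rwa [opT_mul, opT_mul] at this
  sum_e_mul_e' := by
    simp only [← MulOpposite.op_mul, ← Finset.op_sum, sum_e''_mul_e, MulOpposite.op_one]
  sum_f'_e' := by
    intro ω
    have := sum_f''_e'' (ω ∘ₗ (MulOpposite.opLinearEquiv ℂ).toLinearMap)
    simp only [← MulOpposite.op_smul, ← Finset.op_sum]
    exact congrArg MulOpposite.op this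
  left_integral := by
    intro φ hφ a
    induction a using MulOpposite.rec' with | _ a
    rw [opΔ_op, sL_opT, left_integral _ hφ]
    simp
  l_left_integral := by
    intro φ hφ a
    induction a using MulOpposite.rec' with | _ a
    rw [opΔ_op, sL_opT]
    exact D.l_left_integral _ hφ a
  right_integral := by
    intro φ hφ a
    induction a using MulOpposite.rec' with | _ a
    rw [opΔ_op, sR_opT, right_integral _ hφ]
    simp
  faithful_left := by
    intro a h
    induction a using MulOpposite.rec' with | _ a
    rw [faithful_left a fun φ hφ b => ?_, MulOpposite.op_zero]
    exact h (φ ∘ₗ (MulOpposite.opLinearEquiv ℂ).symm.toLinearMap) hφ (MulOpposite.op b)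
  faithful_right := by
    intro a h
    induction a using MulOpposite.rec' with | _ a
    rw [faithful_right a fun φ hφ b => ?_, MulOpposite.op_zero]
    exact h (φ ∘ₗ (MulOpposite.opLinearEquiv ℂ).symm.toLinearMap) hφ (MulOpposite.op b)
  full := by
    rw [eq_top_iff]
    have h := congrArg (Submodule.map (MulOpposite.opLinearEquiv ℂ (M := A)).toLinearMap) D.full
    rw [Submodule.map_span, Submodule.map_top, LinearEquiv.range] at h
    rw [← h]
    apply Submodule.span_mono
    rintro _ ⟨_, ⟨ω, a, rfl⟩, rfl⟩
    exact ⟨ω ∘ₗ (MulOpposite.opLinearEquiv ℂ).symm.toLinearMap, MulOpposite.op a,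
      (sL_opT (ω ∘ₗ (MulOpposite.opLinearEquiv ℂ).symm.toLinearMap) (D.Δ a)).symm⟩

lemma bijective_S (D' : IntegralData Aᵐᵒᵖ) (hΔ : D'.Δ = D.opΔ)
    (hΦ : D'.Φ = {φ | φ ∘ₗ (MulOpposite.opLinearEquiv ℂ).toLinearMap ∈ D.Φ}) :
    Function.Bijective D.S := by
  have hS' : ∀ φ ∈ D'.Φ, ∀ a b : A, D'.S (sL φ (D'.Δ (MulOpposite.op a) *
      (1 ⊗ₜ[ℂ] MulOpposite.op b))) = MulOpposite.op (sL
        (φ ∘ₗ (MulOpposite.opLinearEquiv ℂ).toLinearMap) (D.Δ b * (1 ⊗ₜ[ℂ] a))) := by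
    intro φ hφ a b
    rw [D'.S_sL hφ, hΔ, opΔ_op, ← sL_opT, opT_mul]
    rfl
  have hD' : ∀ φ : Aᵐᵒᵖ →ₗ[ℂ] ℂ, ∀ a b : A,
      sL φ (D'.Δ (MulOpposite.op a) * (1 ⊗ₜ[ℂ] MulOpposite.op b)) = MulOpposite.op
        (sL (φ ∘ₗ (MulOpposite.opLinearEquiv ℂ).toLinearMap) ((1 ⊗ₜ[ℂ] b) * D.Δ a)) := by
    intro φ a b
    rw [hΔ, opΔ_op, ← sL_opT, opT_mul]
    rfl
  have left_inv : D'.S ∘ₗ (MulOpposite.opLinearEquiv ℂ).toLinearMap ∘ₗ D.S =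
      (MulOpposite.opLinearEquiv ℂ).toLinearMap := by
    apply D.ext_of_faithful
    intro φ hφ a b
    have h : φ ∘ₗ (MulOpposite.opLinearEquiv ℂ).symm.toLinearMap ∈ D'.Φ := by
      rw [hΦ]
      exact hφ
    have h1 := hS' _ h b a
    rw [hD'] at h1
    rw [LinearMap.comp_apply, LinearMap.comp_apply, D.S_sL hφ]
    exact h1
  have right_inv : D.S ∘ₗ (MulOpposite.opLinearEquiv ℂ).symm.toLinearMap ∘ₗ D'.S =
      (MulOpposite.opLinearEquiv ℂ).symm.toLinearMap := by
    apply D'.ext_of_faithful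
    intro φ hφ a b
    induction a using MulOpposite.rec' with | _ a
    induction b using MulOpposite.rec' with | _ b
    have h : φ ∘ₗ (MulOpposite.opLinearEquiv ℂ).toLinearMap ∈ D.Φ := by
      rw [hΦ] at hφ
      exact hφ
    rw [LinearMap.comp_apply, LinearMap.comp_apply, hS' φ hφ, hD']
    exact D.S_sL h b a
  constructor
  · intro x y hxy
    have hx := LinearMap.congr_fun left_inv x
    have hy := LinearMap.congr_fun left_inv y
    simp only [LinearMap.comp_apply, hxy] at hx hy
    exact (MulOpposite.opLinearEquiv ℂ).injective (hx.symm.trans hy)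
  · intro x
    exact ⟨_, LinearMap.congr_fun right_inv (MulOpposite.op x)⟩

end IntegralData
section Coassociativity

variable {A : Type} [Ring A] [Algebra ℂ A] (Δ : A →ₗ[ℂ] A ⊗[ℂ] A)

lemma lTensor_sL_assoc_rTensor (ω : A →ₗ[ℂ] ℂ) (t : A ⊗[ℂ] A) :
    LinearMap.lTensor A (sL ω) (TensorProduct.assoc ℂ A A A (LinearMap.rTensor A Δ t)) =
      Δ (sL ω t) := by
  induction t with
  | zero => simp
  | add x y hx hy => simp only [map_add, hx, hy]
  | tmul u v =>
    simp only [LinearMap.rTensor_tmul, sL_tmul, map_smul]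
    induction Δ u with
    | zero => simp
    | add x y hx hy => simp only [map_add, TensorProduct.add_tmul, smul_add, hx, hy]
    | tmul x y => simp

lemma sR_lTensor (ω : A →ₗ[ℂ] ℂ) (t : A ⊗[ℂ] A) :
    sR ω (LinearMap.lTensor A Δ t) = Δ (sR ω t) := by
  induction t with
  | zero => simp
  | add x y hx hy => simp only [map_add, hx, hy]
  | tmul u v => simp

lemma sL_lTensor_sL (l φ : A →ₗ[ℂ] ℂ) (t : A ⊗[ℂ] A) :
    sL l (LinearMap.lTensor A (sL φ) (LinearMap.lTensor A Δ t)) = sL (l ∘ₗ sL φ ∘ₗ Δ) t := by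
  induction t with
  | zero => simp
  | add x y hx hy => simp only [map_add, hx, hy]
  | tmul u v => simp

lemma sR_sR_assoc_rTensor (l ψ : A →ₗ[ℂ] ℂ) (t : A ⊗[ℂ] A) :
    sR l (sR ψ (TensorProduct.assoc ℂ A A A (LinearMap.rTensor A Δ t))) =
      sR (l ∘ₗ sR ψ ∘ₗ Δ) t := by
  induction t with
  | zero => simp
  | add x y hx hy => simp only [map_add, hx, hy]
  | tmul u v =>
    simp only [LinearMap.rTensor_tmul, sR_tmul, LinearMap.comp_apply]
    induction Δ u with
    | zero => simp
    | add x y hx hy => simp only [map_add, TensorProduct.add_tmul, add_smul, hx, hy]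
    | tmul x y => simp [smul_smul]

lemma lTensor_sL_leg12_mul (ω : A →ₗ[ℂ] ℂ) (t s : A ⊗[ℂ] A) :
    LinearMap.lTensor A (sL ω) (leg12 A t * ((1 : A) ⊗ₜ[ℂ] s)) = t * (1 ⊗ₜ[ℂ] sL ω s) := by
  induction t with
  | zero => simp
  | add x y hx hy => simp only [map_add, add_mul, hx, hy]
  | tmul u v =>
    induction s with
    | zero => simp
    | add x y hx hy => simp only [map_add, mul_add, TensorProduct.tmul_add, hx, hy]
    | tmul x y => simp [leg12]

lemma lTensor_sL_mul_leg12 (ω : A →ₗ[ℂ] ℂ) (t s : A ⊗[ℂ] A) :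
    LinearMap.lTensor A (sL ω) (((1 : A) ⊗ₜ[ℂ] s) * leg12 A t) = (1 ⊗ₜ[ℂ] sL ω s) * t := by
  induction t with
  | zero => simp
  | add x y hx hy => simp only [map_add, mul_add, hx, hy]
  | tmul u v =>
    induction s with
    | zero => simp
    | add x y hx hy =>
      simp only [map_add, add_mul, TensorProduct.tmul_add, hx, hy]
    | tmul x y => simp [leg12]

lemma sR_leg12_mul (ω : A →ₗ[ℂ] ℂ) (t s : A ⊗[ℂ] A) :
    sR ω (leg12 A t * ((1 : A) ⊗ₜ[ℂ] s)) = (sR ω t ⊗ₜ[ℂ] 1) * s := by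
  induction t with
  | zero => simp
  | add x y hx hy => simp only [map_add, add_mul, TensorProduct.add_tmul, hx, hy]
  | tmul u v => simp [leg12, ← TensorProduct.smul_tmul']

lemma sR_mul_leg12 (ω : A →ₗ[ℂ] ℂ) (t s : A ⊗[ℂ] A) :
    sR ω (((1 : A) ⊗ₜ[ℂ] s) * leg12 A t) = s * (sR ω t ⊗ₜ[ℂ] 1) := by
  induction t with
  | zero => simp
  | add x y hx hy => simp only [map_add, mul_add, TensorProduct.add_tmul, hx, hy]
  | tmul u v => simp [leg12, ← TensorProduct.smul_tmul']

end Coassociativity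

section Subalgebra

variable {A : Type} [Ring A] [Algebra ℂ A] {B C : Subalgebra ℂ A}

lemma coe_sL_comp_val (ω : A →ₗ[ℂ] ℂ) (t : B ⊗[ℂ] C) :
    ((sL (ω ∘ₗ C.val.toLinearMap) t : B) : A) =
      sL ω (TensorProduct.map B.val.toLinearMap C.val.toLinearMap t) := by
  induction t with
  | zero => simp
  | add x y hx hy => simp only [map_add, ← hx, ← hy, AddMemClass.coe_add]
  | tmul x y => simp

lemma coe_sR_comp_val (ω : A →ₗ[ℂ] ℂ) (t : B ⊗[ℂ] C) :
    ((sR (ω ∘ₗ B.val.toLinearMap) t : C) : A) =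
      sR ω (TensorProduct.map B.val.toLinearMap C.val.toLinearMap t) := by
  induction t with
  | zero => simp
  | add x y hx hy => simp only [map_add, ← hx, ← hy, AddMemClass.coe_add]
  | tmul x y => simp

lemma exists_sL_eq {t : B ⊗[ℂ] C}
    (h : Submodule.span ℂ {x : B | ∃ ω : C →ₗ[ℂ] ℂ, x = sL ω t} = ⊤) (b : B) :
    ∃ ω : A →ₗ[ℂ] ℂ, sL ω (TensorProduct.map B.val.toLinearMap C.val.toLinearMap t) = b := by
  have hb : b ∈ Submodule.span ℂ {x : B | ∃ ω : C →ₗ[ℂ] ℂ, x = sL ω t} := h ▸ Submodule.mem_top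
  induction hb using Submodule.span_induction with
  | zero => exact ⟨0, by simp [sL]⟩
  | mem x hx =>
    obtain ⟨ω, rfl⟩ := hx
    obtain ⟨ω', rfl⟩ := LinearMap.exists_extend (p := Subalgebra.toSubmodule C) ω
    exact ⟨ω', (coe_sL_comp_val ω' t).symm⟩
  | add x y _ _ hx hy =>
    obtain ⟨ω, hω⟩ := hx
    obtain ⟨ω', hω'⟩ := hy
    exact ⟨ω + ω', by simp [sL, LinearMap.lTensor_add, ← hω, ← hω']⟩
  | smul r x _ hx =>
    obtain ⟨ω, hω⟩ := hx
    exact ⟨r • ω, by simp [sL, LinearMap.lTensor_smul, ← hω]⟩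

lemma exists_sR_eq {t : B ⊗[ℂ] C}
    (h : Submodule.span ℂ {x : C | ∃ ω : B →ₗ[ℂ] ℂ, x = sR ω t} = ⊤) (c : C) :
    ∃ ω : A →ₗ[ℂ] ℂ, sR ω (TensorProduct.map B.val.toLinearMap C.val.toLinearMap t) = c := by
  have hc : c ∈ Submodule.span ℂ {x : C | ∃ ω : B →ₗ[ℂ] ℂ, x = sR ω t} := h ▸ Submodule.mem_top
  induction hc using Submodule.span_induction with
  | zero => exact ⟨0, by simp [sR]⟩
  | mem x hx =>
    obtain ⟨ω, rfl⟩ := hx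
    obtain ⟨ω', rfl⟩ := LinearMap.exists_extend (p := Subalgebra.toSubmodule B) ω
    exact ⟨ω', (coe_sR_comp_val ω' t).symm⟩
  | add x y _ _ hx hy =>
    obtain ⟨ω, hω⟩ := hx
    obtain ⟨ω', hω'⟩ := hy
    exact ⟨ω + ω', by simp [sR, LinearMap.rTensor_add, ← hω, ← hω']⟩
  | smul r x _ hx =>
    obtain ⟨ω, hω⟩ := hx
    exact ⟨r • ω, by simp [sR, LinearMap.rTensor_smul, ← hω]⟩

end Subalgebra

/-- A full coproduct whose canonical idempotent `Δ 1 = ∑ i, e i ⊗ f i` is a regular separability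
idempotent in `B ⊗ C`; `lB` and `lC` extend the distinguished functionals on `B` and `C`. -/
structure SeparableCoproduct (A : Type) [Ring A] [Algebra ℂ A] where
  Δ : A →ₗ[ℂ] A ⊗[ℂ] A
  (B C : Subalgebra ℂ A)
  n : ℕ
  e : Fin n → B
  f : Fin n → C
  SB : B ≃ₗ[ℂ] C
  SC : C ≃ₗ[ℂ] B
  (lB lC : A →ₗ[ℂ] ℂ)
  map_mul : ∀ a b, Δ (a * b) = Δ a * Δ b
  coassoc : ∀ a, TensorProduct.assoc ℂ A A A (LinearMap.rTensor A Δ (Δ a)) =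
    LinearMap.lTensor A Δ (Δ a)
  map_one : Δ 1 = ∑ i, (e i : A) ⊗ₜ[ℂ] (f i : A)
  map_one_mul : ∀ b : B, Δ 1 * ((b : A) ⊗ₜ[ℂ] 1) = Δ 1 * (1 ⊗ₜ[ℂ] (SB b : A))
  mul_map_one : ∀ c : C, (1 ⊗ₜ[ℂ] (c : A)) * Δ 1 = ((SC c : A) ⊗ₜ[ℂ] 1) * Δ 1
  map_B : ∀ b : B, Δ b = Δ 1 * (1 ⊗ₜ[ℂ] (b : A))
  map_B' : ∀ b : B, Δ b = (1 ⊗ₜ[ℂ] (b : A)) * Δ 1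
  map_C : ∀ c : C, Δ c = (c : A) ⊗ₜ[ℂ] 1 * Δ 1
  map_C' : ∀ c : C, Δ c = Δ 1 * ((c : A) ⊗ₜ[ℂ] 1)
  sR_lB : sR lB (Δ 1) = 1
  sL_lC : sL lC (Δ 1) = 1
  fullL : Submodule.span ℂ {x : A | ∃ ω : A →ₗ[ℂ] ℂ, ∃ a : A, x = sL ω (Δ a)} = ⊤
  fullR : Submodule.span ℂ {x : A | ∃ ω : A →ₗ[ℂ] ℂ, ∃ a : A, x = sR ω (Δ a)} = ⊤

namespace SeparableCoproduct

variable {A : Type} [Ring A] [Algebra ℂ A] (D : SeparableCoproduct A)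

lemma one_mul_map (a : A) : D.Δ 1 * D.Δ a = D.Δ a := by rw [← D.map_mul, one_mul]

lemma map_mul_one (a : A) : D.Δ a * D.Δ 1 = D.Δ a := by rw [← D.map_mul, mul_one]

lemma map_B_mul (b : D.B) (x : A) : D.Δ (b * x) = (1 ⊗ₜ[ℂ] (b : A)) * D.Δ x := by
  rw [D.map_mul, D.map_B', mul_assoc, one_mul_map]

lemma map_mul_B (b : D.B) (x : A) : D.Δ (x * b) = D.Δ x * (1 ⊗ₜ[ℂ] (b : A)) := by
  rw [D.map_mul, D.map_B, ← mul_assoc, map_mul_one]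

lemma map_C_mul (c : D.C) (x : A) : D.Δ (c * x) = ((c : A) ⊗ₜ[ℂ] 1) * D.Δ x := by
  rw [D.map_mul, D.map_C, mul_assoc, one_mul_map]

lemma map_mul_C (c : D.C) (x : A) : D.Δ (x * c) = D.Δ x * ((c : A) ⊗ₜ[ℂ] 1) := by
  rw [D.map_mul, D.map_C', ← mul_assoc, map_mul_one]

lemma sum_lC_mul_SB (b : D.B) : ∑ i, D.lC (D.f i * D.SB b) • D.e i = b := by
  have h := congrArg (sL D.lC) (D.map_one_mul b)
  rw [sL_mul_tmul_one, D.sL_lC, D.map_one, Finset.sum_mul] at h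
  apply Subtype.ext
  simpa using h.symm

lemma sum_lC_mul (c : D.C) : ∑ i, D.lC (c * D.f i) • D.e i = D.SC c := by
  have h := congrArg (sL D.lC) (D.mul_map_one c)
  rw [sL_tmul_one_mul, D.sL_lC, D.map_one, Finset.mul_sum] at h
  apply Subtype.ext
  simpa using h

lemma sum_lB_mul (b : D.B) : ∑ i, D.lB (D.e i * b) • D.f i = D.SB b := by
  have h := congrArg (sR D.lB) (D.map_one_mul b)
  rw [sR_mul_one_tmul, D.sR_lB, D.map_one, Finset.sum_mul] at h
  apply Subtype.ext
  simpa using h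

lemma sum_lB_SC_mul (c : D.C) : ∑ i, D.lB (D.SC c * D.e i) • D.f i = c := by
  have h := congrArg (sR D.lB) (D.mul_map_one c)
  rw [sR_one_tmul_mul, D.sR_lB, D.map_one, Finset.mul_sum] at h
  apply Subtype.ext
  simpa using h.symm

lemma sum_lC_smul_SB (c : D.C) : ∑ i, D.lC (D.f i * c) • D.SB (D.e i) = c := by
  have h := congrArg D.SB (D.sum_lC_mul_SB (D.SB.symm c))
  simpa using h

lemma sum_lC_smul_SC_symm (c : D.C) : ∑ i, D.lC (c * D.f i) • D.SC.symm (D.e i) = c := by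
  have h := congrArg D.SC.symm (D.sum_lC_mul c)
  simpa using h

lemma sum_lB_smul_SC (b : D.B) : ∑ i, D.lB (b * D.e i) • D.SC (D.f i) = b := by
  have h := congrArg D.SC (D.sum_lB_SC_mul (D.SC.symm b))
  simpa using h

lemma sum_lB_smul_SB_symm (b : D.B) : ∑ i, D.lB (D.e i * b) • D.SB.symm (D.f i) = b := by
  have h := congrArg D.SB.symm (D.sum_lB_mul b)
  simpa using h

lemma sum_SB_SC (ω : A →ₗ[ℂ] ℂ) :
    ∑ i, ω (D.SB (D.e i)) • (D.SC (D.f i) : A) = ∑ i, ω (D.f i) • (D.e i : A) := by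
  have h : ∀ j, ω (D.f j) = ∑ i, D.lC (D.f i * D.f j) * ω (D.SB (D.e i)) := by
    intro j
    have := congrArg (fun c : D.C => ω c) (D.sum_lC_smul_SB (D.f j))
    simpa using this.symm
  simp only [h, ← D.sum_lC_mul, AddSubmonoidClass.coe_finsetSum, Finset.smul_sum,
    Finset.sum_smul]
  rw [Finset.sum_comm]
  simp [smul_smul, mul_comm]

lemma sum_SC_symm_SB_symm (ω : A →ₗ[ℂ] ℂ) :
    ∑ i, ω (D.SC.symm (D.e i)) • (D.SB.symm (D.f i) : A) = ∑ i, ω (D.f i) • (D.e i : A) := by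
  have h : ∀ j, ω (D.f j) = ∑ i, D.lC (D.f j * D.f i) * ω (D.SC.symm (D.e i)) := by
    intro j
    have := congrArg (fun c : D.C => ω c) (D.sum_lC_smul_SC_symm (D.f j))
    simpa using this.symm
  have h' : ∀ c, D.SB.symm c = ∑ i, D.lC (D.f i * c) • D.e i := by
    intro c
    simpa using (D.sum_lC_mul_SB (D.SB.symm c)).symm
  simp only [h, h', AddSubmonoidClass.coe_finsetSum, Finset.smul_sum,
    Finset.sum_smul]
  rw [Finset.sum_comm]
  simp [smul_smul, mul_comm]

lemma sum_mul_SC : ∑ i, (D.e i * D.SC (D.f i) : A) = 1 := by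
  have h : D.Δ 1 * D.Δ 1 = ((∑ i, (D.e i * D.SC (D.f i) : A)) ⊗ₜ[ℂ] 1) * D.Δ 1 := by
    conv_lhs => rw [D.map_one, Finset.sum_mul, ← D.map_one]
    rw [TensorProduct.sum_tmul, Finset.sum_mul]
    refine Finset.sum_congr rfl fun i _ => ?_
    have h1 : (D.e i : A) ⊗ₜ[ℂ] (D.f i : A) = ((D.e i : A) ⊗ₜ[ℂ] 1) * (1 ⊗ₜ[ℂ] (D.f i : A)) := by
      simp
    rw [h1, mul_assoc, D.mul_map_one, ← mul_assoc]
    simp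
  have h2 := congrArg (sL D.lC) h
  rw [one_mul_map, sL_tmul_one_mul, D.sL_lC, mul_one] at h2
  exact h2.symm

lemma sum_SB_symm_mul : ∑ i, (D.SB.symm (D.f i) * D.e i : A) = 1 := by
  have h : D.Δ 1 * D.Δ 1 = D.Δ 1 * ((∑ i, (D.SB.symm (D.f i) * D.e i : A)) ⊗ₜ[ℂ] 1) := by
    conv_lhs =>
      enter [2]
      rw [D.map_one]
    rw [TensorProduct.sum_tmul, Finset.mul_sum, Finset.mul_sum]
    refine Finset.sum_congr rfl fun i _ => ?_
    have h1 : (D.e i : A) ⊗ₜ[ℂ] (D.f i : A) = (1 ⊗ₜ[ℂ] (D.f i : A)) * ((D.e i : A) ⊗ₜ[ℂ] 1) := by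
      simp
    have h2 := D.map_one_mul (D.SB.symm (D.f i))
    rw [LinearEquiv.apply_symm_apply] at h2
    rw [h1, ← mul_assoc, ← h2, mul_assoc]
    simp
  have h2 := congrArg (sL D.lC) h
  rw [one_mul_map, sL_mul_tmul_one, D.sL_lC, one_mul] at h2
  exact h2.symm

lemma lC_left_integral {φ : A →ₗ[ℂ] ℂ} (hφ : IsLeftIntegral A D.Δ D.C φ) (a : A) :
    D.lC (sL φ (D.Δ a)) = φ a := by
  suffices D.lC ∘ₗ sL φ ∘ₗ D.Δ = φ from LinearMap.congr_fun this a
  apply LinearMap.ext_on D.fullR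
  rintro _ ⟨ω, x, rfl⟩
  rw [← apply_sL_eq_apply_sR, ← apply_sL_eq_apply_sR, ← sL_lTensor_sL, ← D.coassoc,
    lTensor_sL_assoc_rTensor, D.map_C' ⟨_, hφ.2 x⟩, sL_mul_tmul_one, D.sL_lC, one_mul]

lemma lB_right_integral {ψ : A →ₗ[ℂ] ℂ} (hψ : IsRightIntegral A D.Δ D.B ψ) (a : A) :
    D.lB (sR ψ (D.Δ a)) = ψ a := by
  suffices D.lB ∘ₗ sR ψ ∘ₗ D.Δ = ψ from LinearMap.congr_fun this a
  apply LinearMap.ext_on D.fullL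
  rintro _ ⟨ω, x, rfl⟩
  rw [apply_sL_eq_apply_sR, apply_sL_eq_apply_sR, ← sR_sR_assoc_rTensor, D.coassoc,
    sR_lTensor, D.map_B ⟨_, hψ.2 x⟩, sR_mul_one_tmul, D.sR_lB, one_mul]

lemma left_integral {φ : A →ₗ[ℂ] ℂ} (hφ : IsLeftIntegral A D.Δ D.C φ) (a : A) :
    sL φ (D.Δ a) = ∑ i, φ (D.f i * a) • (D.SB (D.e i) : A) := by
  have h := congrArg Subtype.val (D.sum_lC_smul_SB ⟨_, hφ.2 a⟩)
  simp only [← D.lC_left_integral hφ, map_C_mul, sL_tmul_one_mul]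
  simpa using h.symm

lemma left_integral' {φ : A →ₗ[ℂ] ℂ} (hφ : IsLeftIntegral A D.Δ D.C φ) (a : A) :
    sL φ (D.Δ a) = ∑ i, φ (a * D.f i) • (D.SC.symm (D.e i) : A) := by
  have h := congrArg Subtype.val (D.sum_lC_smul_SC_symm ⟨_, hφ.2 a⟩)
  simp only [← D.lC_left_integral hφ, map_mul_C, sL_mul_tmul_one]
  simpa using h.symm

lemma right_integral {ψ : A →ₗ[ℂ] ℂ} (hψ : IsRightIntegral A D.Δ D.B ψ) (a : A) :
    sR ψ (D.Δ a) = ∑ i, ψ (a * D.e i) • (D.SC (D.f i) : A) := by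
  have h := congrArg Subtype.val (D.sum_lB_smul_SC ⟨_, hψ.2 a⟩)
  simp only [← D.lB_right_integral hψ, map_mul_B, sR_mul_one_tmul]
  simpa using h.symm

lemma right_integral' {ψ : A →ₗ[ℂ] ℂ} (hψ : IsRightIntegral A D.Δ D.B ψ) (a : A) :
    sR ψ (D.Δ a) = ∑ i, ψ (D.e i * a) • (D.SB.symm (D.f i) : A) := by
  have h := congrArg Subtype.val (D.sum_lB_smul_SB_symm ⟨_, hψ.2 a⟩)
  simp only [← D.lB_right_integral hψ, map_B_mul, sR_one_tmul_mul]
  simpa using h.symm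

/-- The integral data given by all left and right integrals. -/
noncomputable def integralData (hL : FaithfulLeftIntegrals A D.Δ D.C)
    (hR : FaithfulRightIntegrals A D.Δ D.B) : IntegralData A where
  Δ := D.Δ
  n := D.n
  e := fun i => D.e i
  f := fun i => D.f i
  e' := fun i => D.SC (D.f i)
  f' := fun i => D.SB (D.e i)
  Φ := {φ | IsLeftIntegral A D.Δ D.C φ}
  Ψ := {ψ | IsRightIntegral A D.Δ D.B ψ}
  l := D.lC
  map_mul := D.map_mul
  coassoc := D.coassoc
  map_one := D.map_one
  map_e_mul := fun i => D.map_B_mul (D.e i)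
  map_mul_e := fun i => D.map_mul_B (D.e i)
  map_mul_f := fun i => D.map_mul_C (D.f i)
  map_one_mul_e := fun i => D.map_one_mul (D.e i)
  sum_e_mul_e' := D.sum_mul_SC
  sum_f'_e' := D.sum_SB_SC
  left_integral := fun _ hφ => D.left_integral hφ
  l_left_integral := fun _ hφ => D.lC_left_integral hφ
  right_integral := fun _ hψ => D.right_integral hψ
  faithful_left := hL.1
  faithful_right := hR.2
  full := D.fullL

/-- The integral data on the opposite algebra given by all left and right integrals. -/
noncomputable def integralDataOp (hL : FaithfulLeftIntegrals A D.Δ D.C)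
    (hR : FaithfulRightIntegrals A D.Δ D.B) : IntegralData Aᵐᵒᵖ :=
  (D.integralData hL hR).op (fun i => D.SB.symm (D.f i)) (fun i => D.SC.symm (D.e i))
    (fun i => D.map_C_mul (D.f i))
    (fun i => by
      have h := D.mul_map_one (D.SC.symm (D.e i))
      rw [LinearEquiv.apply_symm_apply] at h
      exact h.symm)
    D.sum_SB_symm_mul D.sum_SC_symm_SB_symm (fun _ hφ => D.left_integral' hφ)
    (fun _ hψ => D.right_integral' hψ) hL.2 hR.1

lemma exists_counit_antipode (hL : FaithfulLeftIntegrals A D.Δ D.C)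
    (hR : FaithfulRightIntegrals A D.Δ D.B) :
    ∃ (ε : A →ₗ[ℂ] ℂ) (S : A →ₗ[ℂ] A),
      (∀ a b : A, sR ε (D.Δ a * ((1 : A) ⊗ₜ[ℂ] b)) = a * b ∧
        sL ε ((a ⊗ₜ[ℂ] (1 : A)) * D.Δ b) = a * b) ∧
      Function.Bijective S ∧
      (∀ a a' : A, S (a * a') = S a' * S a) ∧
      (∀ a : A, LinearMap.mul' ℂ A (TensorProduct.map S LinearMap.id (D.Δ a)) =
        sL ε (((1 : A) ⊗ₜ[ℂ] a) * D.Δ 1)) ∧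
      (∀ a : A, LinearMap.mul' ℂ A (TensorProduct.map LinearMap.id S (D.Δ a)) =
        sR ε (D.Δ 1 * (a ⊗ₜ[ℂ] (1 : A)))) ∧
      (∀ x : D.B, S (x : A) = ((D.SB x : D.C) : A)) ∧
      (∀ y : D.C, S (y : A) = ((D.SC y : D.B) : A)) := by
  let I := D.integralData hL hR
  have hsL : ∀ a, sL I.ε (D.Δ a) = a := I.sL_ε
  have hmap : ∀ a, LinearMap.mul' ℂ A (TensorProduct.map I.S LinearMap.id (D.Δ a)) =
    sL I.ε ((1 ⊗ₜ[ℂ] a) * D.Δ 1) := I.mul'_map_S_map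
  have hS : ∀ x, I.S x =
    LinearMap.mul' ℂ A (TensorProduct.map I.S LinearMap.id (D.Δ 1 * (x ⊗ₜ[ℂ] 1))) := I.S_eq
  refine ⟨I.ε, I.S, fun a b => ⟨?_, ?_⟩,
    I.bijective_S (D.integralDataOp hL hR) rfl rfl, I.S_mul, hmap,
    I.mul'_map_id_S_map, fun x => ?_, fun y => ?_⟩
  · rw [sR_mul_one_tmul]
    exact congrArg (· * b) (I.sR_ε a)
  · rw [sL_tmul_one_mul, hsL]
  · have h : ∀ (z : A ⊗[ℂ] A) (q : A),
        LinearMap.mul' ℂ A (TensorProduct.map I.S LinearMap.id (z * (1 ⊗ₜ[ℂ] q))) =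
          LinearMap.mul' ℂ A (TensorProduct.map I.S LinearMap.id z) * q := by
      intro z q
      induction z with
      | zero => simp
      | add x y hx hy => simp only [map_add, add_mul, hx, hy]
      | tmul x y => simp [mul_assoc]
    rw [hS, D.map_one_mul, h, hmap, ← Algebra.TensorProduct.one_def, one_mul, hsL, one_mul]
  · rw [hS, ← D.map_C', hmap, D.mul_map_one, sL_tmul_one_mul, hsL, mul_one]

end SeparableCoproduct

theorem statement19
    (A : Type) [Ring A] [Algebra ℂ A]
    (Δ : A →ₗ[ℂ] A ⊗[ℂ] A)
    (hΔmul : ∀ a a' : A, Δ (a * a') = Δ a * Δ a')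
    (hΔcoassoc : ∀ a : A,
      TensorProduct.assoc ℂ A A A (LinearMap.rTensor A Δ (Δ a)) = LinearMap.lTensor A Δ (Δ a))
    (hΔfullL : Submodule.span ℂ {x : A | ∃ ω : A →ₗ[ℂ] ℂ, ∃ a : A, x = sL ω (Δ a)} = ⊤)
    (hΔfullR : Submodule.span ℂ {x : A | ∃ ω : A →ₗ[ℂ] ℂ, ∃ a : A, x = sR ω (Δ a)} = ⊤)
    (E : A ⊗[ℂ] A)
    (hEE : E * E = E)
    (hEΔ : ∀ a : A, E * Δ a = Δ a ∧ Δ a * E = Δ a)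
    (hranL : (Submodule.span ℂ {y : A ⊗[ℂ] A | ∃ a z, y = Δ a * z} : Set (A ⊗[ℂ] A)) =
      {y : A ⊗[ℂ] A | ∃ z, y = E * z})
    (hranR : (Submodule.span ℂ {y : A ⊗[ℂ] A | ∃ a z, y = z * Δ a} : Set (A ⊗[ℂ] A)) =
      {y : A ⊗[ℂ] A | ∃ z, y = z * E})
    (hΔE1 : TensorProduct.assoc ℂ A A A (LinearMap.rTensor A Δ E) =
      leg12 A E * ((1 : A) ⊗ₜ[ℂ] E))
    (hΔE2 : leg12 A E * ((1 : A) ⊗ₜ[ℂ] E) = ((1 : A) ⊗ₜ[ℂ] E) * leg12 A E)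
    (B C : Subalgebra ℂ A)
    (E' : ↥B ⊗[ℂ] ↥C)
    (hE'E : TensorProduct.map B.val.toLinearMap C.val.toLinearMap E' = E)
    (hE'full1 : Submodule.span ℂ {x : ↥B | ∃ ω : ↥C →ₗ[ℂ] ℂ, x = sL ω E'} = ⊤)
    (hE'full2 : Submodule.span ℂ {y : ↥C | ∃ ω : ↥B →ₗ[ℂ] ℂ, y = sR ω E'} = ⊤)
    (SB : ↥B ≃ₗ[ℂ] ↥C) (SC : ↥C ≃ₗ[ℂ] ↥B)
    (hSBanti : ∀ b b' : ↥B, SB (b * b') = SB b' * SB b)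
    (hSCanti : ∀ c c' : ↥C, SC (c * c') = SC c' * SC c)
    (hSBrel : ∀ b : ↥B, E' * (b ⊗ₜ[ℂ] (1 : ↥C)) = E' * ((1 : ↥B) ⊗ₜ[ℂ] SB b))
    (hSCrel : ∀ c : ↥C, ((1 : ↥B) ⊗ₜ[ℂ] c) * E' = (SC c ⊗ₜ[ℂ] (1 : ↥C)) * E')
    (hfaithL : FaithfulLeftIntegrals A Δ C)
    (hfaithR : FaithfulRightIntegrals A Δ B) :
    ∃ (ε : A →ₗ[ℂ] ℂ) (S : A →ₗ[ℂ] A),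
      (∀ a b : A, sR ε (Δ a * ((1 : A) ⊗ₜ[ℂ] b)) = a * b ∧
        sL ε ((a ⊗ₜ[ℂ] (1 : A)) * Δ b) = a * b) ∧
      Function.Bijective S ∧
      (∀ a a' : A, S (a * a') = S a' * S a) ∧
      (∀ a : A, LinearMap.mul' ℂ A (TensorProduct.map S LinearMap.id (Δ a)) =
        sL ε (((1 : A) ⊗ₜ[ℂ] a) * E)) ∧
      (∀ a : A, LinearMap.mul' ℂ A (TensorProduct.map LinearMap.id S (Δ a)) =
        sR ε (E * (a ⊗ₜ[ℂ] (1 : A)))) ∧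
      (∀ x : ↥B, S (x : A) = ((SB x : ↥C) : A)) ∧
      (∀ y : ↥C, S (y : A) = ((SC y : ↥B) : A)) := by
  have hone : Δ 1 = E := by
    have hE : E ∈ Submodule.span ℂ {y : A ⊗[ℂ] A | ∃ a z, y = Δ a * z} := by
      rw [← SetLike.mem_coe, hranL]
      exact ⟨1, (mul_one E).symm⟩
    have h : ∀ y ∈ Submodule.span ℂ {y : A ⊗[ℂ] A | ∃ a z, y = Δ a * z}, Δ 1 * y = y := by
      intro y hy
      induction hy using Submodule.span_induction with
      | zero => simp
      | mem y hy =>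
        obtain ⟨a, z, rfl⟩ := hy
        rw [← mul_assoc, ← hΔmul, one_mul]
      | add x y _ _ hx hy => rw [mul_add, hx, hy]
      | smul r x _ hx => rw [mul_smul_comm, hx]
    exact (hEΔ 1).2.symm.trans (h E hE)
  subst hone
  have hB : ∀ b : B, ∃ ω : A →ₗ[ℂ] ℂ, sL ω (Δ 1) = b := hE'E ▸ exists_sL_eq hE'full1
  have hC : ∀ c : C, ∃ ω : A →ₗ[ℂ] ℂ, sR ω (Δ 1) = c := hE'E ▸ exists_sR_eq hE'full2
  have hmap : Algebra.TensorProduct.map B.val C.val E' = Δ 1 := hE'E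
  obtain ⟨lC, hlC⟩ := hB 1
  obtain ⟨lB, hlB⟩ := hC 1
  obtain ⟨n, e, f, hef⟩ := TensorProduct.exists_sum_tmul_eq E'
  let D : SeparableCoproduct A :=
    { Δ := Δ
      B := B
      C := C
      n := n
      e := e
      f := f
      SB := SB
      SC := SC
      lB := lB
      lC := lC
      map_mul := hΔmul
      coassoc := hΔcoassoc
      map_one := by rw [← hE'E, hef]; simp
      map_one_mul := fun b => by
        have h := congrArg (Algebra.TensorProduct.map B.val C.val) (hSBrel b)
        rw [_root_.map_mul, _root_.map_mul, hmap] at h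
        simpa using h
      mul_map_one := fun c => by
        have h := congrArg (Algebra.TensorProduct.map B.val C.val) (hSCrel c)
        rw [_root_.map_mul, _root_.map_mul, hmap] at h
        simpa using h
      map_B := fun b => by
        obtain ⟨ω, hω⟩ := hB b
        rw [← hω, ← lTensor_sL_assoc_rTensor, hΔE1, lTensor_sL_leg12_mul]
      map_B' := fun b => by
        obtain ⟨ω, hω⟩ := hB b
        rw [← hω, ← lTensor_sL_assoc_rTensor, hΔE1, hΔE2, lTensor_sL_mul_leg12]
      map_C := fun c => by
        obtain ⟨ω, hω⟩ := hC c
        rw [← hω, ← sR_lTensor, ← hΔcoassoc, hΔE1, sR_leg12_mul]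
      map_C' := fun c => by
        obtain ⟨ω, hω⟩ := hC c
        rw [← hω, ← sR_lTensor, ← hΔcoassoc, hΔE1, hΔE2, sR_mul_leg12]
      sR_lB := hlB
      sL_lC := hlC
      fullL := hΔfullL
      fullR := hΔfullR }
  exact D.exists_counit_antipode hfaithL hfaithR
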